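/- If a 2-iSAT formula F has no satisfying interpretation, then the digraph G_F contains a bicycle, i.e., a directed walk u_0 → u_1 → ⋯ → u_{ℓ+1} in G_F with at least one clause arc such that (a) the literals of the vertices u_1, …, u_ℓ are pairwise distinct, (b) the literal of u_0 and the literal of u_{ℓ+1} each occur among the literals of u_1, …, u_ℓ, and (c) the clauses giving rise to the clause arcs of the walk are pairwise distinct. -/

import Mathlib

/-- A signed literal `x ∈ I` where `I = [lo, hi]` is a nonempty closed subinterval
of `[0,1]`. -/
structure ISatLiteral (V : Type*) where
  var : V
  lo : ℝ
  hi : ℝ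
  lo_le_hi : lo ≤ hi
  lo_nonneg : 0 ≤ lo
  hi_le_one : hi ≤ 1

/-- The interval (sign) of a literal. -/
def ISatLiteral.interval {V : Type*} (L : ISatLiteral V) : Set ℝ := Set.Icc L.lo L.hi

/-- A 2-clause: a pair of two literals (the pair is to be thought of as unordered;
all notions below are symmetric in the two components). -/
abbrev ISatClause (V : Type*) := ISatLiteral V × ISatLiteral V

/-- A 2-iSAT formula: a finite list of 2-clauses. -/
abbrev ISatFormula (V : Type*) := List (ISatClause V)

/-- An interpretation `v : V → [0,1]` satisfies `F` if every clause contains a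
literal `(x, I)` with `v(x) ∈ I`. -/
def ISatFormula.Satisfies {V : Type*} (F : ISatFormula V) (v : V → ℝ) : Prop :=
  (∀ x : V, v x ∈ Set.Icc (0 : ℝ) 1) ∧
  ∀ c ∈ F, v c.1.var ∈ c.1.interval ∨ v c.2.var ∈ c.2.interval

/-- A literal occurs in the formula `F`. -/
def ISatFormula.OccursIn {V : Type*} (F : ISatFormula V) (L : ISatLiteral V) : Prop :=
  ∃ c ∈ F, L = c.1 ∨ L = c.2

/-- A vertex of the digraph `G_F`: a literal together with a boolean
(`true` = the positive vertex `(L,t)`, `false` = the negative vertex `(L,f)`). -/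
abbrev ISatVertex (V : Type*) := ISatLiteral V × Bool

/-- The two clause arcs `(L,f) → (L',t)` and `(L',f) → (L,t)` arising from a clause
`{L, L'}`. -/
def ISatClause.ClauseArc {V : Type*} (c : ISatClause V) (u w : ISatVertex V) : Prop :=
  (u = (c.1, false) ∧ w = (c.2, true)) ∨ (u = (c.2, false) ∧ w = (c.1, true))

/-- A disjointness arc `(L,t) → (L',f)` of `G_F`: `L` and `L'` occur in `F`, have the
same variable, and their intervals are disjoint. -/
def ISatFormula.DisjArc {V : Type*} (F : ISatFormula V) (u w : ISatVertex V) : Prop :=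
  F.OccursIn u.1 ∧ F.OccursIn w.1 ∧ u.2 = true ∧ w.2 = false ∧
  u.1.var = w.1.var ∧ u.1.interval ∩ w.1.interval = ∅

/-- A bicycle in `G_F`: a directed walk `u 0 → u 1 → ⋯ → u (ℓ+1)`, each step being
either a clause arc arising from a clause `cl i = some c` with `c ∈ F`, or a
disjointness arc (`cl i = none`); there is at least one clause arc; the literals of
`u 1, …, u ℓ` are pairwise distinct; the literals of `u 0` and `u (ℓ+1)` occur among
those of `u 1, …, u ℓ`; and the clauses giving rise to the clause arcs are pairwise
distinct. -/
def ISatFormula.HasBicycle {V : Type*} (F : ISatFormula V) : Prop :=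
  ∃ (ℓ : ℕ) (u : ℕ → ISatVertex V) (cl : ℕ → Option (ISatClause V)),
    (∀ i : ℕ, i ≤ ℓ →
      (∃ c : ISatClause V, cl i = some c ∧ c ∈ F ∧ c.ClauseArc (u i) (u (i + 1))) ∨
      (cl i = none ∧ F.DisjArc (u i) (u (i + 1)))) ∧
    (∃ i : ℕ, i ≤ ℓ ∧ cl i ≠ none) ∧
    (∀ i j : ℕ, 1 ≤ i → i ≤ ℓ → 1 ≤ j → j ≤ ℓ → i ≠ j → (u i).1 ≠ (u j).1) ∧
    (∃ i : ℕ, 1 ≤ i ∧ i ≤ ℓ ∧ (u 0).1 = (u i).1) ∧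
    (∃ i : ℕ, 1 ≤ i ∧ i ≤ ℓ ∧ (u (ℓ + 1)).1 = (u i).1) ∧
    (∀ i j : ℕ, i ≤ ℓ → j ≤ ℓ → i ≠ j →
      ∀ c : ISatClause V, cl i = some c → cl j ≠ some c)

def ISatFormula.Arc {V : Type*} (F : ISatFormula V) (u w : ISatVertex V) : Prop :=
  (∃ c : ISatClause V, c ∈ F ∧ c.ClauseArc u w) ∨ F.DisjArc u w

theorem isat_arc_sign {V : Type*} {F : ISatFormula V} {u w : ISatVertex V}
    (h : F.Arc u w) : w.2 = !u.2 := by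
  rcases h with ⟨c, -, (⟨rfl, rfl⟩ | ⟨rfl, rfl⟩)⟩ | ⟨-, -, h1, h2, -⟩
  · rfl
  · rfl
  · simp [h1, h2]

theorem isat_arc_occurs {V : Type*} {F : ISatFormula V} {u w : ISatVertex V}
    (h : F.Arc u w) : F.OccursIn u.1 := by
  rcases h with ⟨c, hc, (⟨rfl, rfl⟩ | ⟨rfl, rfl⟩)⟩ | ⟨h1, -⟩
  · exact ⟨c, hc, Or.inl rfl⟩
  · exact ⟨c, hc, Or.inr rfl⟩
  · exact h1

theorem isat_occurs_finite {V : Type*} (F : ISatFormula V) :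
    {L | F.OccursIn L}.Finite := by
  classical
  refine ((F.map Prod.fst ++ F.map Prod.snd).finite_toSet).subset ?_
  rintro L ⟨c, hc, rfl | rfl⟩
  · exact List.mem_append_left _ (List.mem_map_of_mem hc)
  · exact List.mem_append_right _ (List.mem_map_of_mem hc)

theorem isat_bicycle_of_walk {V : Type*} (F : ISatFormula V) (w : ℕ → ISatVertex V)
    (hw : ∀ n, F.Arc (w n) (w (n + 1))) (l : ℕ)
    (hd : ∀ i j : ℕ, 1 ≤ i → i < j → j ≤ l → (w i).1 ≠ (w j).1)
    (h0 : ∃ i : ℕ, 1 ≤ i ∧ i ≤ l ∧ (w 0).1 = (w i).1)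
    (h1 : ∃ i : ℕ, 1 ≤ i ∧ i ≤ l ∧ (w (l + 1)).1 = (w i).1)
    (hne : w 0 = w l → (w 0).2 = true) : F.HasBicycle := by
  have hcl : ∀ i, ∃ o : Option (ISatClause V),
      (∃ c : ISatClause V, o = some c ∧ c ∈ F ∧ c.ClauseArc (w i) (w (i + 1))) ∨
      (o = none ∧ F.DisjArc (w i) (w (i + 1))) := by
    intro i
    rcases hw i with ⟨c, hc, h⟩ | h
    · exact ⟨some c, Or.inl ⟨c, rfl, hc, h⟩⟩
    · exact ⟨none, Or.inr ⟨rfl, h⟩⟩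
  choose cl hcl using hcl
  have hl : 1 ≤ l := by obtain ⟨i, h, h', -⟩ := h0; omega
  have hd' : ∀ i j : ℕ, 1 ≤ i → i ≤ l → 1 ≤ j → j ≤ l → (w i).1 = (w j).1 → i = j := by
    intro i j hi hi' hj hj' e
    rcases lt_trichotomy i j with h | h | h
    · exact absurd e (hd i j hi h hj')
    · exact h
    · exact absurd e.symm (hd j i hj h hi')
  have key : ∀ i j : ℕ, i < j → j ≤ l → ∀ c, cl i = some c → cl j = some c → False := by
    intro i j hij hj c hi' hj'
    have ai : c.ClauseArc (w i) (w (i + 1)) := by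
      rcases hcl i with ⟨c', e, -, h⟩ | ⟨e, -⟩
      · rw [hi'] at e; cases e; exact h
      · rw [hi'] at e; cases e
    have aj : c.ClauseArc (w j) (w (j + 1)) := by
      rcases hcl j with ⟨c', e, -, h⟩ | ⟨e, -⟩
      · rw [hj'] at e; cases e; exact h
      · rw [hj'] at e; cases e
    have same : w i = w j → w (i + 1) = w (j + 1) → (w i).2 = false → False := by
      intro e1 e2 hs
      have hi0 : i = 0 := by
        by_contra h
        have := hd' i j (by omega) (by omega) (by omega) hj (by rw [e1])
        omega
      subst hi0
      have hjl : j = l := by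
        by_contra h
        have := hd' (0 + 1) (j + 1) (by omega) (by omega) (by omega) (by omega) (by rw [e2])
        omega
      subst hjl
      have := hne e1
      simp [hs] at this
    have opp : (w (i + 1)).1 = (w j).1 → (w (i + 1)).2 = true → (w j).2 = false → False := by
      intro e1 s1 s2
      have := hd' (i + 1) j (by omega) (by omega) (by omega) hj e1
      subst this
      simp [s1] at s2
    rcases ai with ⟨a1, a2⟩ | ⟨a1, a2⟩ <;> rcases aj with ⟨b1, b2⟩ | ⟨b1, b2⟩
    · exact same (by rw [a1, b1]) (by rw [a2, b2]) (by rw [a1])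
    · exact opp (by rw [a2, b1]) (by rw [a2]) (by rw [b1])
    · exact opp (by rw [a2, b1]) (by rw [a2]) (by rw [b1])
    · exact same (by rw [a1, b1]) (by rw [a2, b2]) (by rw [a1])
  refine ⟨l, w, cl, fun i _ => hcl i, ?_, ?_, h0, h1, ?_⟩
  · by_contra hcon
    push Not at hcon
    have n0 := hcon 0 (by omega)
    have n1 := hcon 1 hl
    rcases hcl 0 with ⟨c, e, -⟩ | ⟨-, -, -, -, d0, -⟩
    · rw [n0] at e; cases e
    rcases hcl 1 with ⟨c, e, -⟩ | ⟨-, -, -, d1, -⟩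
    · rw [n1] at e; cases e
    simp [d1] at d0
  · intro i j hi hi' hj hj' hij e
    exact hij (hd' i j hi hi' hj hj' e)
  · intro i j hi hj hij c e1 e2
    rcases lt_or_gt_of_ne hij with h | h
    · exact key i j h hj c e1 e2
    · exact key j i h hi c e2 e1

theorem isat_bicycle_of_infinite {V : Type*} (F : ISatFormula V) (w : ℕ → ISatVertex V)
    (nxt : ISatVertex V → ISatVertex V) (hn : ∀ n, w (n + 1) = nxt (w n))
    (hw : ∀ n, F.Arc (w n) (w (n + 1))) : F.HasBicycle := by
  classical
  have pig : ∀ s : ℕ, ∃ a b, s ≤ a ∧ a < b ∧ (w a).1 = (w b).1 := by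
    intro s
    by_contra hcon
    push Not at hcon
    have hinj : Function.Injective (fun n : ℕ => (w (s + n)).1) := by
      intro a b e
      by_contra hab
      rcases lt_or_gt_of_ne hab with h | h
      · exact hcon (s + a) (s + b) (by omega) (by omega) e
      · exact hcon (s + b) (s + a) (by omega) (by omega) e.symm
    refine Set.infinite_range_of_injective hinj ((isat_occurs_finite F).subset ?_)
    rintro _ ⟨n, rfl⟩
    exact isat_arc_occurs (hw _)
  have hex : ∃ d, 1 ≤ d ∧ ∃ i, (w i).1 = (w (i + d)).1 := by
    obtain ⟨a, b, -, hab, e⟩ := pig 0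
    exact ⟨b - a, by omega, a, by rw [e]; congr 2; omega⟩
  obtain ⟨hd1, i, hi⟩ := Nat.find_spec hex
  have hmin : ∀ a b, a < b → b < a + Nat.find hex → (w a).1 ≠ (w b).1 := by
    intro a b hab hb e
    exact Nat.find_min hex (m := b - a) (by omega)
      ⟨by omega, a, by rw [e]; congr 2; omega⟩
  generalize Nat.find hex = d at hd1 hi hmin
  by_cases hs : w i = w (i + d)
  · have hp : ∃ p, w p = w (p + d) ∧ (w p).2 = true := by
      by_cases ht : (w i).2 = true
      · exact ⟨i, hs, ht⟩
      · refine ⟨i + 1, ?_, ?_⟩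
        · rw [hn, hs, ← hn]; congr 1; omega
        · rw [isat_arc_sign (hw i)]; simpa using ht
    obtain ⟨p, hp, ht⟩ := hp
    refine isat_bicycle_of_walk F (fun n => w (p + n)) (fun n => hw (p + n)) d ?_ ?_ ?_ ?_
    · intro a b ha hab hb
      exact hmin _ _ (by omega) (by omega)
    · exact ⟨d, hd1, le_rfl, by simp [← hp]⟩
    · refine ⟨1, le_rfl, hd1, ?_⟩
      show (w ((p + d) + 1)).1 = _
      rw [hn, ← hp, ← hn]
    · intro _; exact ht
  · have hk : ∃ k, ∃ m, i + 1 ≤ m ∧ m < k ∧ (w m).1 = (w k).1 := by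
      obtain ⟨a, b, h1, h2, h3⟩ := pig (i + 1)
      exact ⟨b, a, h1, h2, h3⟩
    obtain ⟨m, hm1, hm2, hm3⟩ := Nat.find_spec hk
    have hkm : ∀ b, b < Nat.find hk → ∀ a, i + 1 ≤ a → a < b → (w a).1 ≠ (w b).1 := by
      intro b hb a ha hab e
      exact Nat.find_min hk hb ⟨a, ha, hab, e⟩
    generalize Nat.find hk = k at hm2 hm3 hkm
    have hkd : i + d < k := by
      by_contra hcon
      exact hmin m k hm2 (by omega) hm3
    obtain ⟨l, rfl⟩ : ∃ l, k = i + (l + 1) := ⟨k - i - 1, by omega⟩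
    refine isat_bicycle_of_walk F (fun n => w (i + n)) (fun n => hw (i + n)) l ?_ ?_ ?_ ?_
    · intro a b ha hab hb
      exact hkm _ (by omega) _ (by omega) (by omega)
    · exact ⟨d, hd1, by omega, hi⟩
    · refine ⟨m - i, by omega, by omega, ?_⟩
      show (w (i + (l + 1))).1 = _
      rw [← hm3]; show _ = (w (i + (m - i))).1; congr 2; omega
    · intro e
      exfalso
      have e' : w i = w (i + l) := e
      rcases lt_or_eq_of_le (show d ≤ l by omega) with h | h
      · exact hkm (i + l) (by omega) (i + d) (by omega) (by omega) (by rw [← hi, e'])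
      · subst h; exact hs e'

theorem isat_sat_of_wf {V : Type*} (F : ISatFormula V)
    (hwf : WellFounded (fun a b => F.Arc b a)) : ∃ v : V → ℝ, F.Satisfies v := by
  classical
  haveI : IsWellFounded _ (fun a b => F.Arc b a) := ⟨hwf⟩
  obtain ⟨rk, hr⟩ : ∃ rk : ISatVertex V → Ordinal, ∀ u w, F.Arc u w → rk w < rk u :=
    ⟨IsWellFounded.rank (fun a b => F.Arc b a), fun u w h => IsWellFounded.rank_lt_of_rel h⟩
  let T : ISatLiteral V → Prop := fun L =>
    F.OccursIn L ∧ rk (L, true) < rk (L, false)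
  have hT : ∀ L M, T L → T M → L.var = M.var → M.lo ≤ L.hi := by
    rintro L M ⟨oL, hL⟩ ⟨oM, hM⟩ hv
    by_contra hcon
    push Not at hcon
    have hdis : L.interval ∩ M.interval = ∅ := by
      ext z
      simp only [ISatLiteral.interval, Set.mem_inter_iff, Set.mem_Icc, Set.mem_empty_iff_false,
        iff_false]
      rintro ⟨⟨_, h1⟩, h2, _⟩
      linarith
    have a1 := hr (L, true) (M, false) (Or.inr ⟨oL, oM, rfl, rfl, hv, hdis⟩)
    have a2 := hr (M, true) (L, false)
      (Or.inr ⟨oM, oL, rfl, rfl, hv.symm, by rw [Set.inter_comm]; exact hdis⟩)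
    exact lt_irrefl _ (a1.trans (hL.trans (a2.trans hM)))
  have hv : ∀ x : V, ∃ r : ℝ, r ∈ Set.Icc (0 : ℝ) 1 ∧
      ∀ L, T L → L.var = x → r ∈ L.interval := by
    intro x
    have hfin : {L | T L ∧ L.var = x}.Finite :=
      (isat_occurs_finite F).subset (fun L h => h.1.1)
    rcases Set.eq_empty_or_nonempty {L | T L ∧ L.var = x} with he | hne
    · refine ⟨0, by simp, fun L hL hx => ?_⟩
      have : L ∈ {L | T L ∧ L.var = x} := ⟨hL, hx⟩
      rw [he] at this
      exact this.elim
    · obtain ⟨M, hM, hmax⟩ := Set.exists_max_image _ ISatLiteral.lo hfin hne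
      refine ⟨M.lo, ⟨M.lo_nonneg, M.lo_le_hi.trans M.hi_le_one⟩, fun L hL hx => ?_⟩
      exact ⟨hmax L ⟨hL, hx⟩, hT L M hL hM.1 (hx.trans hM.2.symm)⟩
  choose v hv1 hv2 using hv
  refine ⟨v, hv1, fun c hc => ?_⟩
  by_contra hcon
  push Not at hcon
  have o1 : F.OccursIn c.1 := ⟨c, hc, Or.inl rfl⟩
  have o2 : F.OccursIn c.2 := ⟨c, hc, Or.inr rfl⟩
  have n1 : rk (c.1, false) ≤ rk (c.1, true) := by
    by_contra h
    exact hcon.1 (hv2 _ _ ⟨o1, not_le.1 h⟩ rfl)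
  have n2 : rk (c.2, false) ≤ rk (c.2, true) := by
    by_contra h
    exact hcon.2 (hv2 _ _ ⟨o2, not_le.1 h⟩ rfl)
  have a1 := hr (c.1, false) (c.2, true) (Or.inl ⟨c, hc, Or.inl ⟨rfl, rfl⟩⟩)
  have a2 := hr (c.2, false) (c.1, true) (Or.inl ⟨c, hc, Or.inr ⟨rfl, rfl⟩⟩)
  exact lt_irrefl _ (a1.trans_le (n1.trans (a2.le.trans n2)))

/-- If a 2-iSAT formula has no satisfying interpretation, then the digraph `G_F`
contains a bicycle. -/
theorem stmt_0 {V : Type*} (F : ISatFormula V)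
    (h : ¬ ∃ v : V → ℝ, F.Satisfies v) : F.HasBicycle := by
  classical
  have hnwf : ¬ WellFounded (fun a b => F.Arc b a) := fun hwf => h (isat_sat_of_wf F hwf)
  have h0 : ∃ a, ¬ Acc (fun a b => F.Arc b a) a := by
    by_contra hcon
    push Not at hcon
    exact hnwf ⟨hcon⟩
  obtain ⟨a, ha⟩ := h0
  have step : ∀ u : ISatVertex V, ∃ w, ¬ Acc (fun a b => F.Arc b a) u →
      F.Arc u w ∧ ¬ Acc (fun a b => F.Arc b a) w := by
    intro u
    by_cases hu : Acc (fun a b => F.Arc b a) u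
    · exact ⟨u, fun h => absurd hu h⟩
    · by_contra hcon
      push Not at hcon
      exact hu ⟨u, fun w hw => by
        by_contra hacc
        exact hacc ((hcon w).2 hw)⟩
  choose nxt hnxt using step
  have hacc : ∀ n, ¬ Acc (fun a b => F.Arc b a) (nxt^[n] a) := by
    intro n
    induction n with
    | zero => exact ha
    | succ n ih => rw [Function.iterate_succ_apply']; exact (hnxt _ ih).2
  refine isat_bicycle_of_infinite F (fun n => nxt^[n] a) nxt
    (fun n => Function.iterate_succ_apply' _ _ _) (fun n => ?_)
  show F.Arc (nxt^[n] a) (nxt^[n + 1] a)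
  rw [Function.iterate_succ_apply']
  exact (hnxt _ (hacc n)).1
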